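/- Under (A0), (B1), (B2), if 𝔼_x(τ_ϑ) = +∞ for all x ∈ E, then the renewal function V(x) = 𝔼_x(𝒯_ϑ) is harmonic for the killed chain (PV = V) and lim_{n→∞} ℙ_x(τ_ϑ > n)/ℙ_e(τ_ϑ > n) = V(x) for every x ∈ E. -/

import Mathlib

open scoped ENNReal Classical BigOperators
open Filter

noncomputable section

namespace RW

variable {G : Type*}

/-- One-step transition operator `Pφ(x) = Σ_y p(x,y) φ(y)`. -/
def kapp (p : G → G → ℝ≥0∞) (φ : G → ℝ≥0∞) (x : G) : ℝ≥0∞ := ∑' y, p x y * φ y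

/-- n-step transition kernel. -/
def kiter (p : G → G → ℝ≥0∞) : ℕ → G → G → ℝ≥0∞
  | 0 => fun x y => if x = y then 1 else 0
  | n + 1 => fun x y => ∑' z, p x z * kiter p n z y

/-- Green function `G(x,y) = Σ_t ℙ_x(X(t)=y)`. -/
def green (p : G → G → ℝ≥0∞) (x y : G) : ℝ≥0∞ := ∑' n, kiter p n x y

/-- Green operator `Gφ(x) = Σ_y G(x,y) φ(y)`. -/
def greenApp (p : G → G → ℝ≥0∞) (φ : G → ℝ≥0∞) (x : G) : ℝ≥0∞ := ∑' y, green p x y * φ y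

/-- Probability of first hitting `y` at time `n ≥ 1`. -/
def fhit (p : G → G → ℝ≥0∞) : ℕ → G → G → ℝ≥0∞
  | 0 => fun _ _ => 0
  | 1 => p
  | n + 2 => fun x y => ∑' z, if z = y then 0 else p x z * fhit p (n + 1) z y

/-- Hitting probability `Q(x,y) = ℙ_x(∃ t ≥ 1, X(t) = y)`. -/
def hitProb (p : G → G → ℝ≥0∞) (x y : G) : ℝ≥0∞ := ∑' n, fhit p n x y

/-- Survival probability `ℙ_x(τ_ϑ > n)`. -/
def surv (p : G → G → ℝ≥0∞) (n : ℕ) (x : G) : ℝ≥0∞ := ∑' y, kiter p n x y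

/-- Expected lifetime `𝔼_x(τ_ϑ) = Σ_n ℙ_x(τ_ϑ > n)`. -/
def gexp (p : G → G → ℝ≥0∞) (x : G) : ℝ≥0∞ := ∑' n, surv p n x

variable [Group G]

/-- Matrix coefficients `a_u(x,y)` of the operator `A_u = T_u P - P T_u`. -/
def acoef (p : G → G → ℝ≥0∞) (E : Set G) (u x y : G) : ℝ≥0∞ :=
  if y * u⁻¹ ∈ E then p (x * u) y - p x (y * u⁻¹) else p (x * u) y

/-- The operator `A_u φ(x) = Σ_y a_u(x,y) φ(y)`. -/
def Aop (p : G → G → ℝ≥0∞) (E : Set G) (u : G) (φ : G → ℝ≥0∞) (x : G) : ℝ≥0∞ :=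
  ∑' y, acoef p E u x y * φ y

/-- Ladder height transition kernel `p_H(x,y) = G A_x 𝟙_{y}(e)`. -/
def ladder (p : G → G → ℝ≥0∞) (E : Set G) (x y : G) : ℝ≥0∞ :=
  ∑' z, green p 1 z * acoef p E x z y

/-- The renewal function `V(x) = 𝔼_x(𝒯_ϑ)` of the ladder height process. -/
def V (p : G → G → ℝ≥0∞) (E : Set G) (x : G) : ℝ≥0∞ :=
  ∑' n, surv (ladder p E) n x

end RW

end

open RW

theorem ENNReal.tsum_liminf_le {α : Type*} (f : ℕ → α → ℝ≥0∞) :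
    ∑' a, liminf (fun n => f n a) atTop ≤ liminf (fun n => ∑' a, f n a) atTop := by
  let _ : MeasurableSpace α := ⊤
  have h := MeasureTheory.lintegral_liminf_le (μ := MeasureTheory.Measure.count) (f := f)
    (u := atTop) (fun _ => measurable_from_top)
  simpa only [MeasureTheory.lintegral_count] using h

theorem ENNReal.sum_liminf_le {α : Type*} (s : Finset α) (f : ℕ → α → ℝ≥0∞) :
    ∑ a ∈ s, liminf (fun n => f n a) atTop ≤ liminf (fun n => ∑ a ∈ s, f n a) atTop := by
  have h := ENNReal.tsum_liminf_le fun n (a : s) => f n a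
  simp only [tsum_fintype] at h
  simpa only [Finset.sum_coe_sort s fun a => liminf (fun n => f n a) atTop,
    Finset.sum_coe_sort s (f _)] using h

theorem ENNReal.add_liminf_eq (c : ℝ≥0∞) (f : ℕ → ℝ≥0∞) :
    c + liminf f atTop = liminf (fun n => c + f n) atTop :=
  Monotone.map_liminf_of_continuousAt (f := fun x => c + x) (fun _ _ h => add_le_add le_rfl h) f
    (by fun_prop)

theorem ENNReal.tsum_iSup_of_monotone {α : Type*} (f : ℕ → α → ℝ≥0∞) (hf : Monotone f) :
    ∑' a, ⨆ n, f n a = ⨆ n, ∑' a, f n a := by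
  let _ : MeasurableSpace α := ⊤
  have h := MeasureTheory.lintegral_iSup (μ := MeasureTheory.Measure.count) (f := f)
    (fun _ => measurable_from_top) hf
  simpa only [MeasureTheory.lintegral_count] using h

theorem ENNReal.tendsto_tsum_of_monotone {α : Type*} {f : ℕ → α → ℝ≥0∞} {g : α → ℝ≥0∞}
    (hf : Monotone f) (h : ∀ a, Tendsto (fun n => f n a) atTop (nhds (g a))) :
    Tendsto (fun n => ∑' a, f n a) atTop (nhds (∑' a, g a)) := by
  have hg : ∀ a, g a = ⨆ n, f n a := fun a =>
    tendsto_nhds_unique (h a) (tendsto_atTop_iSup fun _ _ hmn => hf hmn a)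
  simp only [hg]
  rw [ENNReal.tsum_iSup_of_monotone f hf]
  exact tendsto_atTop_iSup fun _ _ hmn => ENNReal.tsum_le_tsum (hf hmn)

theorem ENNReal.tsum_sum_range_eq (B : ℕ → ℕ → ℝ≥0∞) :
    ∑' n, ∑ k ∈ Finset.range n, B k (n - 1 - k) = ∑' k, ∑' m, B k m := by
  rw [tsum_eq_zero_add' ENNReal.summable]
  simp only [Finset.range_zero, Finset.sum_empty, zero_add, Nat.add_sub_cancel]
  rw [← ENNReal.tsum_prod,
    ← Finset.HasAntidiagonal.sigmaAntidiagonalEquivProd.tsum_eq (fun q : ℕ × ℕ => B q.1 q.2),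
    ENNReal.tsum_sigma']
  refine tsum_congr fun n => ?_
  rw [tsum_fintype, ← Finset.Nat.sum_antidiagonal_eq_sum_range_succ B n]
  exact (Finset.sum_coe_sort (Finset.HasAntidiagonal.antidiagonal n) (fun q => B q.1 q.2)).symm

namespace RW

section Kernel

variable {G : Type*}

theorem kapp_mono {p q : G → G → ℝ≥0∞} {φ ψ : G → ℝ≥0∞} {x : G}
    (hpq : ∀ y, p x y ≤ q x y) (h : ∀ y, p x y ≠ 0 → φ y ≤ ψ y) :
    kapp p φ x ≤ kapp q ψ x := by
  refine ENNReal.tsum_le_tsum fun y => ?_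
  by_cases hy : p x y = 0
  · simp [hy]
  · exact mul_le_mul' (hpq y) (h y hy)

theorem kapp_congr {p : G → G → ℝ≥0∞} {φ ψ : G → ℝ≥0∞} {x : G}
    (h : ∀ y, p x y ≠ 0 → φ y = ψ y) : kapp p φ x = kapp p ψ x :=
  le_antisymm (kapp_mono (fun _ => le_rfl) fun y hy => (h y hy).le)
    (kapp_mono (fun _ => le_rfl) fun y hy => (h y hy).ge)

theorem kapp_add (p : G → G → ℝ≥0∞) (φ ψ : G → ℝ≥0∞) (x : G) :
    kapp p (fun y => φ y + ψ y) x = kapp p φ x + kapp p ψ x := by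
  simp only [kapp, mul_add, ENNReal.tsum_add]

theorem kapp_sum {ι : Type*} (p : G → G → ℝ≥0∞) (s : Finset ι) (φ : ι → G → ℝ≥0∞) (x : G) :
    kapp p (fun y => ∑ i ∈ s, φ i y) x = ∑ i ∈ s, kapp p (φ i) x := by
  simp only [kapp, Finset.mul_sum]
  exact Summable.tsum_finsetSum fun _ _ => ENNReal.summable

theorem kapp_tsum {ι : Type*} (p : G → G → ℝ≥0∞) (φ : ι → G → ℝ≥0∞) (x : G) :
    kapp p (fun y => ∑' i, φ i y) x = ∑' i, kapp p (φ i) x := by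
  simp only [kapp, ← ENNReal.tsum_mul_left]
  exact ENNReal.tsum_comm

theorem kapp_mul_const (p : G → G → ℝ≥0∞) (φ : G → ℝ≥0∞) (c : ℝ≥0∞) (x : G) :
    kapp p (fun y => φ y * c) x = kapp p φ x * c := by
  simp only [kapp, ← mul_assoc, ENNReal.tsum_mul_right]

theorem kapp_liminf_le (p : ℕ → G → G → ℝ≥0∞) (φ : ℕ → G → ℝ≥0∞) (x : G) :
    kapp (fun x y => liminf (fun n => p n x y) atTop) (fun y => liminf (fun n => φ n y) atTop) x ≤
      liminf (fun n => kapp (p n) (φ n) x) atTop :=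
  (ENNReal.tsum_le_tsum fun _ => ENNReal.le_liminf_mul).trans (ENNReal.tsum_liminf_le _)

theorem kapp_const_liminf_le (p : G → G → ℝ≥0∞) (φ : ℕ → G → ℝ≥0∞) (x : G) :
    kapp p (fun y => liminf (fun n => φ n y) atTop) x ≤
      liminf (fun n => kapp p (φ n) x) atTop := by
  simpa only [liminf_const] using kapp_liminf_le (fun _ => p) φ x

theorem kapp_kiter_zero (p : G → G → ℝ≥0∞) (φ : G → ℝ≥0∞) (x : G) :
    kapp (kiter p 0) φ x = φ x := by
  unfold kapp
  rw [tsum_eq_single x]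
  · simp [kiter]
  · intro y hy
    simp [kiter, Ne.symm hy]

theorem kapp_kiter_succ (p : G → G → ℝ≥0∞) (n : ℕ) (φ : G → ℝ≥0∞) (x : G) :
    kapp (kiter p (n + 1)) φ x = kapp p (kapp (kiter p n) φ) x := by
  simp only [kapp, kiter, ← ENNReal.tsum_mul_left, ← ENNReal.tsum_mul_right]
  rw [ENNReal.tsum_comm]
  simp only [mul_assoc]

theorem surv_eq_kapp (p : G → G → ℝ≥0∞) (n : ℕ) (x : G) :
    surv p n x = kapp (kiter p n) (fun _ => 1) x := by
  simp [surv, kapp]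

theorem surv_zero (p : G → G → ℝ≥0∞) (x : G) : surv p 0 x = 1 := by
  rw [surv_eq_kapp, kapp_kiter_zero]

theorem surv_succ (p : G → G → ℝ≥0∞) (n : ℕ) (x : G) :
    surv p (n + 1) x = kapp p (surv p n) x := by
  rw [surv_eq_kapp, kapp_kiter_succ]
  exact kapp_congr fun y _ => (surv_eq_kapp p n y).symm

theorem surv_le_one {p : G → G → ℝ≥0∞} (hsub : ∀ x, ∑' y, p x y ≤ 1) (n : ℕ) (x : G) :
    surv p n x ≤ 1 := by
  induction n generalizing x with
  | zero => rw [surv_zero]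
  | succ n ih =>
    rw [surv_succ]
    refine le_trans (kapp_mono (ψ := fun _ => 1) (fun _ => le_rfl) fun y _ => ih y) ?_
    simpa [kapp] using hsub x

theorem surv_antitone {p : G → G → ℝ≥0∞} (hsub : ∀ x, ∑' y, p x y ≤ 1) (x : G) :
    Antitone fun n => surv p n x := by
  refine antitone_nat_of_succ_le fun n => ?_
  induction n generalizing x with
  | zero => rw [surv_zero]; exact surv_le_one hsub 1 x
  | succ n ih =>
    rw [surv_succ, surv_succ p n]
    exact kapp_mono (fun _ => le_rfl) fun y _ => ih y

theorem surv_add (p : G → G → ℝ≥0∞) (k n : ℕ) (x : G) :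
    surv p (k + n) x = kapp (kiter p k) (surv p n) x := by
  induction k generalizing x with
  | zero => rw [kapp_kiter_zero, zero_add]
  | succ k ih =>
    rw [Nat.succ_add, surv_succ, kapp_kiter_succ]
    exact kapp_congr fun y _ => ih y

theorem surv_ne_zero {p : G → G → ℝ≥0∞} (hsub : ∀ x, ∑' y, p x y ≤ 1) {x : G}
    (hinf : gexp p x = ⊤) (n : ℕ) : surv p n x ≠ 0 := by
  intro h0
  have h : gexp p x = ∑ k ∈ Finset.range n, surv p k x := by
    refine tsum_eq_sum fun k hk => ?_
    have hnk : n ≤ k := by simpa using hk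
    exact le_antisymm (h0 ▸ surv_antitone hsub x hnk) zero_le
  rw [hinf] at h
  exact ENNReal.sum_ne_top.2
    (fun k _ => ((surv_le_one hsub k x).trans_lt ENNReal.one_lt_top).ne) h.symm

theorem gexp_eq_one_add (p : G → G → ℝ≥0∞) (x : G) : gexp p x = 1 + kapp p (gexp p) x := by
  unfold gexp
  rw [kapp_tsum, tsum_eq_zero_add' ENNReal.summable, surv_zero]
  simp only [surv_succ]

theorem fhit_le_kiter (p : G → G → ℝ≥0∞) (n : ℕ) (x y : G) : fhit p n x y ≤ kiter p n x y := by
  induction n generalizing x with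
  | zero => simp [fhit]
  | succ n ih =>
    cases n with
    | zero => simp [fhit, kiter]
    | succ n =>
      refine ENNReal.tsum_le_tsum fun z => ?_
      split_ifs
      · exact zero_le
      · exact mul_le_mul' le_rfl (ih z)

theorem exists_kiter_ne_zero {p : G → G → ℝ≥0∞} {x y : G} (h : 0 < hitProb p x y) :
    ∃ n, kiter p n x y ≠ 0 := by
  by_contra! hn
  refine h.ne' (ENNReal.tsum_eq_zero.2 fun n => le_antisymm ?_ zero_le)
  exact hn n ▸ fhit_le_kiter p n x y

theorem kiter_smul {a : ℝ≥0∞} (p : G → G → ℝ≥0∞) (n : ℕ) (x y : G) :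
    kiter (fun x y => a * p x y) n x y = a ^ n * kiter p n x y := by
  induction n generalizing x with
  | zero => simp [kiter]
  | succ n ih =>
    simp only [kiter, ih, ← ENNReal.tsum_mul_left]
    exact tsum_congr fun z => by ring

theorem surv_smul {a : ℝ≥0∞} (p : G → G → ℝ≥0∞) (n : ℕ) (x : G) :
    surv (fun x y => a * p x y) n x = a ^ n * surv p n x := by
  simp only [surv, kiter_smul, ENNReal.tsum_mul_left]

theorem kiter_le_kiter {p q : G → G → ℝ≥0∞} (h : ∀ x y, p x y ≤ q x y) (n : ℕ) (x y : G) :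
    kiter p n x y ≤ kiter q n x y := by
  induction n generalizing x with
  | zero => exact le_rfl
  | succ n ih => exact ENNReal.tsum_le_tsum fun z => mul_le_mul' (h x z) (ih z)

end Kernel

variable {G : Type*} [Group G]

/-- A kernel carried by the semigroup `E` and monotone under right translations. -/
structure IsMonotoneKernel (p : G → G → ℝ≥0∞) (E : Set G) : Prop where
  mem_of_ne_zero : ∀ x y, p x y ≠ 0 → x ∈ E ∧ y ∈ E
  one_mem : (1 : G) ∈ E
  mul_mem : ∀ x ∈ E, ∀ y ∈ E, x * y ∈ E
  le_translate : ∀ x ∈ E, ∀ y ∈ E, ∀ u ∈ E, p x y ≤ p (x * u) (y * u)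

theorem acoef_smul {a : ℝ≥0∞} (ha : a ≠ ⊤) (p : G → G → ℝ≥0∞) (E : Set G) (u x y : G) :
    acoef (fun x y => a * p x y) E u x y = a * acoef p E u x y := by
  unfold acoef
  split_ifs
  · rw [ENNReal.mul_sub fun _ _ => ha]
  · rfl

theorem ladder_smul {a : ℝ≥0∞} (ha : a ≠ ⊤) (p : G → G → ℝ≥0∞) (E : Set G) (x y : G) :
    ladder (fun x y => a * p x y) E x y =
      ∑' q : G × ℕ, a ^ (q.2 + 1) * (kiter p q.2 1 q.1 * acoef p E x q.1 y) := by
  rw [ENNReal.tsum_prod']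
  unfold ladder green
  refine tsum_congr fun z => ?_
  rw [← ENNReal.tsum_mul_right]
  refine tsum_congr fun n => ?_
  rw [kiter_smul, acoef_smul ha]
  ring

theorem ladder_smul_mono {a b : ℝ≥0∞} (hb : b ≠ ⊤) (hab : a ≤ b) (p : G → G → ℝ≥0∞)
    (E : Set G) (x y : G) :
    ladder (fun x y => a * p x y) E x y ≤ ladder (fun x y => b * p x y) E x y := by
  rw [ladder_smul (ne_top_of_le_ne_top hb hab), ladder_smul hb]
  exact ENNReal.tsum_le_tsum fun q => by gcongr

theorem V_smul_mono {a b : ℝ≥0∞} (hb : b ≠ ⊤) (hab : a ≤ b) (p : G → G → ℝ≥0∞)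
    (E : Set G) (x : G) :
    V (fun x y => a * p x y) E x ≤ V (fun x y => b * p x y) E x :=
  ENNReal.tsum_le_tsum fun _ => ENNReal.tsum_le_tsum fun _ =>
    kiter_le_kiter (ladder_smul_mono hb hab p E) _ _ _

theorem tsum_kapp_kiter_Aop (p : G → G → ℝ≥0∞) (E : Set G) (u : G) (φ : G → ℝ≥0∞) :
    ∑' k, kapp (kiter p k) (Aop p E u φ) 1 = kapp (ladder p E) φ u := by
  simp only [kapp, ladder, green, Aop, ← ENNReal.tsum_mul_right, ← ENNReal.tsum_mul_left]
  calc ∑' k, ∑' z, ∑' y, kiter p k 1 z * (acoef p E u z y * φ y)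
      = ∑' z, ∑' k, ∑' y, kiter p k 1 z * (acoef p E u z y * φ y) := ENNReal.tsum_comm
    _ = ∑' z, ∑' y, ∑' k, kiter p k 1 z * (acoef p E u z y * φ y) :=
        tsum_congr fun _ => ENNReal.tsum_comm
    _ = ∑' y, ∑' z, ∑' k, kiter p k 1 z * (acoef p E u z y * φ y) := ENNReal.tsum_comm
    _ = _ := by simp only [mul_assoc]

theorem V_eq_one_add (p : G → G → ℝ≥0∞) (E : Set G) (x : G) :
    V p E x = 1 + kapp (ladder p E) (V p E) x :=
  gexp_eq_one_add (ladder p E) x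

namespace IsMonotoneKernel

variable {p : G → G → ℝ≥0∞} {E : Set G}

theorem smul (h : IsMonotoneKernel p E) (a : ℝ≥0∞) :
    IsMonotoneKernel (fun x y => a * p x y) E where
  mem_of_ne_zero x y hxy := h.mem_of_ne_zero x y (right_ne_zero_of_mul hxy)
  one_mem := h.one_mem
  mul_mem := h.mul_mem
  le_translate x hx y hy u hu := mul_le_mul' le_rfl (h.le_translate x hx y hy u hu)

theorem translate_add_acoef (h : IsMonotoneKernel p E) {z u : G} (hz : z ∈ E) (hu : u ∈ E)
    (y : G) : p z (y * u⁻¹) + acoef p E u z y = p (z * u) y := by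
  unfold acoef
  split_ifs with hy
  · refine add_tsub_cancel_of_le ?_
    simpa using h.le_translate z hz _ hy u hu
  · have h0 : p z (y * u⁻¹) = 0 := by
      by_contra hne
      exact hy (h.mem_of_ne_zero _ _ hne).2
    rw [h0, zero_add]

theorem kapp_translate (h : IsMonotoneKernel p E) {z u : G} (hz : z ∈ E) (hu : u ∈ E)
    (φ : G → ℝ≥0∞) :
    kapp p φ (z * u) = kapp p (fun w => φ (w * u)) z + Aop p E u φ z := by
  have h1 : kapp p (fun w => φ (w * u)) z = ∑' y, p z (y * u⁻¹) * φ y := by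
    rw [← (Equiv.mulRight u).tsum_eq fun y => p z (y * u⁻¹) * φ y]
    simp [kapp]
  rw [h1, Aop, ← ENNReal.tsum_add]
  exact tsum_congr fun y => by rw [← add_mul, h.translate_add_acoef hz hu]

theorem surv_translate (h : IsMonotoneKernel p E) {z u : G} (hz : z ∈ E) (hu : u ∈ E) (n : ℕ) :
    surv p n (z * u) = surv p n z +
      ∑ k ∈ Finset.range n, kapp (kiter p k) (Aop p E u (surv p (n - 1 - k))) z := by
  induction n generalizing z with
  | zero => simp [surv_zero]
  | succ n ih =>
    rw [surv_succ, h.kapp_translate hz hu,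
      kapp_congr fun w hw => ih (h.mem_of_ne_zero _ _ hw).2, kapp_add, kapp_sum, surv_succ,
      Finset.sum_range_succ', kapp_kiter_zero, add_assoc]
    simp only [kapp_kiter_succ]
    congr 2
    refine Finset.sum_congr rfl fun k _ => ?_
    rw [show n + 1 - 1 - (k + 1) = n - 1 - k by omega]

theorem ladder_mem (h : IsMonotoneKernel p E) {x y : G} (hxy : ladder p E x y ≠ 0) : y ∈ E := by
  by_contra hy
  refine hxy (ENNReal.tsum_eq_zero.2 fun z => ?_)
  have h1 : p (z * x) y = 0 := by
    by_contra hne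
    exact hy (h.mem_of_ne_zero _ _ hne).2
  simp [acoef, h1]

theorem gexp_eq_add_ladder (h : IsMonotoneKernel p E) {u : G} (hu : u ∈ E) :
    gexp p u = gexp p 1 + kapp (ladder p E) (gexp p) u := by
  have h1 := fun n => h.surv_translate h.one_mem hu n
  simp only [one_mul] at h1
  calc gexp p u = ∑' n, (surv p n 1 +
        ∑ k ∈ Finset.range n, kapp (kiter p k) (Aop p E u (surv p (n - 1 - k))) 1) :=
        tsum_congr h1
    _ = gexp p 1 + ∑' k, ∑' m, kapp (kiter p k) (Aop p E u (surv p m)) 1 := by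
        rw [ENNReal.tsum_add,
          ENNReal.tsum_sum_range_eq fun k m => kapp (kiter p k) (Aop p E u (surv p m)) 1]
        rfl
    _ = gexp p 1 + kapp (ladder p E) (gexp p) u := by
        rw [ENNReal.tsum_comm]
        simp only [tsum_kapp_kiter_Aop]
        rw [← kapp_tsum]
        rfl

theorem V_le_of_one_add_le (h : IsMonotoneKernel p E) {F : G → ℝ≥0∞}
    (hF : ∀ x ∈ E, 1 + kapp (ladder p E) F x ≤ F x) {x : G} (hx : x ∈ E) : V p E x ≤ F x := by
  unfold V
  rw [ENNReal.tsum_eq_iSup_nat]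
  refine iSup_le fun n => ?_
  induction n generalizing x with
  | zero => simp
  | succ n ih =>
    refine le_trans ?_ (hF x hx)
    rw [Finset.sum_range_succ', surv_zero, add_comm]
    simp only [surv_succ]
    rw [← kapp_sum]
    gcongr
    exact kapp_mono (fun _ => le_rfl) fun y hy => ih (h.ladder_mem hy)

theorem gexp_eq_sum_add (h : IsMonotoneKernel p E) (n : ℕ) {x : G} (hx : x ∈ E) :
    gexp p x = (∑ k ∈ Finset.range n, surv (ladder p E) k x) * gexp p 1 +
      kapp (kiter (ladder p E) n) (gexp p) x := by
  induction n generalizing x with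
  | zero => simp [kapp_kiter_zero]
  | succ n ih =>
    rw [h.gexp_eq_add_ladder hx, kapp_congr fun y hy => ih (h.ladder_mem hy), kapp_add,
      kapp_mul_const, kapp_sum, Finset.sum_range_succ', surv_zero, kapp_kiter_succ]
    simp only [surv_succ]
    ring

theorem V_mul_gexp_one (h : IsMonotoneKernel p E) {C : ℝ≥0∞} (hC : C ≠ ⊤)
    (hp : ∀ x, gexp p x ≤ C) {x : G} (hx : x ∈ E) : V p E x * gexp p 1 = gexp p x := by
  have hle : V p E x * gexp p 1 ≤ gexp p x := by
    unfold V
    rw [ENNReal.tsum_eq_iSup_nat, ENNReal.iSup_mul]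
    refine iSup_le fun n => ?_
    rw [h.gexp_eq_sum_add n hx]
    exact le_self_add
  refine le_antisymm hle ?_
  have h1 : 1 ≤ gexp p 1 := by
    rw [gexp_eq_one_add]
    exact le_self_add
  have hV : V p E x ≠ ⊤ := by
    refine ne_top_of_le_ne_top hC (le_trans ?_ (hle.trans (hp x)))
    exact le_mul_of_one_le_right zero_le h1
  have hlim : Tendsto (fun n => V p E x * gexp p 1 + surv (ladder p E) n x * C) atTop
      (nhds (V p E x * gexp p 1 + 0 * C)) :=
    tendsto_const_nhds.add
      (ENNReal.Tendsto.mul_const (ENNReal.tendsto_atTop_zero_of_tsum_ne_top hV) (Or.inr hC))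
  rw [zero_mul, add_zero] at hlim
  refine ge_of_tendsto' hlim fun n => ?_
  rw [h.gexp_eq_sum_add n hx]
  gcongr
  · exact ENNReal.sum_le_tsum _
  · rw [surv_eq_kapp, ← kapp_mul_const]
    simp only [one_mul]
    exact kapp_mono (fun _ => le_rfl) fun y _ => hp y

theorem V_eq_inv_add_kapp (h : IsMonotoneKernel p E) {C : ℝ≥0∞} (hC : C ≠ ⊤)
    (hp : ∀ x, gexp p x ≤ C) {x : G} (hx : x ∈ E) :
    V p E x = (gexp p 1)⁻¹ + kapp p (V p E) x := by
  have h0 : gexp p 1 ≠ 0 := by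
    rw [gexp_eq_one_add]
    simp
  have ht : gexp p 1 ≠ ⊤ := ne_top_of_le_ne_top hC (hp 1)
  have hV : ∀ y ∈ E, V p E y = gexp p y * (gexp p 1)⁻¹ := fun y hy => by
    rw [← h.V_mul_gexp_one hC hp hy, mul_assoc, ENNReal.mul_inv_cancel h0 ht, mul_one]
  rw [kapp_congr fun y hy => hV y (h.mem_of_ne_zero _ _ hy).2, kapp_mul_const, hV x hx,
    gexp_eq_one_add p x]
  ring

theorem kapp_V_eq (h : IsMonotoneKernel p E) (hsub : ∀ x, ∑' y, p x y ≤ 1)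
    (hinf : gexp p 1 = ⊤) {x : G} (hx : x ∈ E) : kapp p (V p E) x = V p E x := by
  obtain ⟨a, ha_mono, ha_lt, ha_lim⟩ := exists_seq_strictMono_tendsto' (zero_lt_one (α := ℝ≥0∞))
  have ha_top : ∀ n, a n ≠ ⊤ := fun n => ((ha_lt n).2.trans ENNReal.one_lt_top).ne
  have hpow : ∀ k, Monotone fun n => a n ^ k := fun k m n hmn =>
    pow_le_pow_left' (ha_mono.monotone hmn) k
  have hpow_lim : ∀ k (c : ℝ≥0∞), Tendsto (fun n => a n ^ k * c) atTop (nhds c) := fun k c => by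
    simpa using ENNReal.Tendsto.mul_const (ENNReal.Tendsto.pow (n := k) ha_lim)
      (Or.inl (by simp : (1 : ℝ≥0∞) ^ k ≠ 0))
  set q : ℕ → G → G → ℝ≥0∞ := fun n x y => a n * p x y with hq
  have hbound : ∀ n x, gexp (q n) x ≤ (1 - a n)⁻¹ := fun n x => by
    rw [← ENNReal.tsum_geometric]
    refine ENNReal.tsum_le_tsum fun k => ?_
    rw [hq, surv_smul]
    exact mul_le_of_le_one_right zero_le (surv_le_one hsub k x)
  have hgeom : ∀ n, (1 - a n)⁻¹ ≠ ⊤ := fun n =>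
    ENNReal.inv_ne_top.2 (tsub_pos_of_lt (ha_lt n).2).ne'
  have hV_mono : Monotone fun n => V (q n) E := fun m n hmn y =>
    V_smul_mono (ha_top n) (ha_mono.monotone hmn) p E y
  set W : G → ℝ≥0∞ := fun y => ⨆ n, V (q n) E y with hW
  have hV_lim : ∀ y, Tendsto (fun n => V (q n) E y) atTop (nhds (W y)) := fun y =>
    tendsto_atTop_iSup fun _ _ hmn => hV_mono hmn y
  have hladder : ∀ y z, Tendsto (fun n => ladder (q n) E y z) atTop (nhds (ladder p E y z)) := by
    intro y z
    have key : ladder p E y z =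
        ∑' r : G × ℕ, kiter p r.2 1 r.1 * acoef p E y r.1 z := by
      simpa using ladder_smul ENNReal.one_ne_top p E y z
    rw [key]
    simp only [hq, ladder_smul (ha_top _)]
    exact ENNReal.tendsto_tsum_of_monotone
      (fun m n hmn r => mul_le_mul' (hpow _ hmn) le_rfl) fun r => hpow_lim _ _
  have hWV : ∀ y ∈ E, W y = V p E y := by
    intro y hy
    refine le_antisymm (iSup_le fun n => ?_) (h.V_le_of_one_add_le ?_ hy)
    · simpa using V_smul_mono ENNReal.one_ne_top (ha_lt n).2.le p E y
    · intro x _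
      calc 1 + kapp (ladder p E) W x
          = 1 + kapp (fun x y => liminf (fun n => ladder (q n) E x y) atTop)
              (fun y => liminf (fun n => V (q n) E y) atTop) x := by
            simp only [(hladder _ _).liminf_eq, (hV_lim _).liminf_eq]
        _ ≤ 1 + liminf (fun n => kapp (ladder (q n) E) (V (q n) E) x) atTop :=
            add_le_add le_rfl (kapp_liminf_le _ _ _)
        _ = W x := by
            rw [ENNReal.add_liminf_eq]
            simp only [← V_eq_one_add]
            exact (hV_lim x).liminf_eq
  have hg_lim : Tendsto (fun n => gexp (q n) 1) atTop (nhds ⊤) := by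
    rw [← hinf]
    simp only [gexp, hq, surv_smul]
    exact ENNReal.tendsto_tsum_of_monotone
      (fun m n hmn k => mul_le_mul' (hpow _ hmn) le_rfl) fun k => hpow_lim _ _
  have hkapp_lim : Tendsto (fun n => kapp (q n) (V (q n) E) x) atTop (nhds (kapp p W x)) := by
    refine ENNReal.tendsto_tsum_of_monotone
      (fun m n hmn y => mul_le_mul' (mul_le_mul' (ha_mono.monotone hmn) le_rfl) (hV_mono hmn y))
      fun y => ?_
    simp only [hq, mul_assoc]
    have h1 : p x y ≠ ⊤ := ne_top_of_le_ne_top ENNReal.one_ne_top ((ENNReal.le_tsum y).trans (hsub x))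
    simpa using ENNReal.Tendsto.mul ha_lim (Or.inl one_ne_zero)
      (ENNReal.Tendsto.const_mul (hV_lim y) (Or.inr h1)) (Or.inr ENNReal.one_ne_top)
  have hsum := (tendsto_inv_iff.2 hg_lim).add hkapp_lim
  rw [ENNReal.inv_top, zero_add] at hsum
  have heq : kapp p W x = W x := by
    refine tendsto_nhds_unique hsum ((hV_lim x).congr fun n => ?_)
    exact (h.smul (a n)).V_eq_inv_add_kapp (hgeom n) (hbound n) hx
  rw [← hWV x hx, ← heq]
  exact kapp_congr fun y hy => (hWV y (h.mem_of_ne_zero _ _ hy).2).symm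

theorem kiter_mem (h : IsMonotoneKernel p E) {k : ℕ} {x y : G} (hx : x ∈ E)
    (hxy : kiter p k x y ≠ 0) : y ∈ E := by
  induction k generalizing x with
  | zero =>
    have : x = y := by
      by_contra hne
      exact hxy (by simp [kiter, hne])
    exact this ▸ hx
  | succ k ih =>
    obtain ⟨z, hz⟩ : ∃ z, p x z * kiter p k z y ≠ 0 := by
      by_contra! hz
      exact hxy (ENNReal.tsum_eq_zero.2 hz)
    exact ih (h.mem_of_ne_zero _ _ (left_ne_zero_of_mul hz)).2 (right_ne_zero_of_mul hz)

theorem kapp_kiter_V_eq (h : IsMonotoneKernel p E) (hsub : ∀ x, ∑' y, p x y ≤ 1)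
    (hinf : gexp p 1 = ⊤) (k : ℕ) {x : G} (hx : x ∈ E) :
    kapp (kiter p k) (V p E) x = V p E x := by
  induction k generalizing x with
  | zero => exact kapp_kiter_zero p _ x
  | succ k ih =>
    rw [kapp_kiter_succ, kapp_congr fun y hy => ih (h.mem_of_ne_zero _ _ hy).2,
      h.kapp_V_eq hsub hinf hx]

theorem V_one (h : IsMonotoneKernel p E) : V p E 1 = 1 := by
  rw [V_eq_one_add]
  have h0 : ∀ y, ladder p E 1 y = 0 := fun y => by
    refine ENNReal.tsum_eq_zero.2 fun z => ?_
    have : acoef p E 1 z y = 0 := by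
      unfold acoef
      split_ifs with hy
      · simp
      · by_contra hne
        exact hy (by simpa using (h.mem_of_ne_zero _ _ hne).2)
    rw [this, mul_zero]
  simp [kapp, h0]

theorem V_le_liminf (h : IsMonotoneKernel p E) (hsub : ∀ x, ∑' y, p x y ≤ 1)
    (hinf : gexp p 1 = ⊤) {x : G} (hx : x ∈ E) :
    V p E x ≤ liminf (fun n => surv p n x / surv p n 1) atTop := by
  refine h.V_le_of_one_add_le (F := fun x => liminf (fun n => surv p n x / surv p n 1) atTop)
    (fun u hu => ?_) hx
  have hs0 := surv_ne_zero hsub hinf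
  have hst : ∀ n, surv p n 1 ≠ ⊤ := fun n => ne_top_of_le_ne_top ENNReal.one_ne_top
    (surv_le_one hsub n 1)
  have hineq : ∀ m n, m ≤ n → 1 + ∑ k ∈ Finset.range m, kapp (kiter p k)
      (Aop p E u (fun y => surv p n y / surv p n 1)) 1 ≤ surv p n u / surv p n 1 := by
    intro m n hmn
    have h1 := h.surv_translate h.one_mem hu n
    rw [one_mul] at h1
    rw [h1, ENNReal.add_div, ENNReal.div_self (hs0 n) (hst n), div_eq_mul_inv, Finset.sum_mul]
    gcongr
    refine (Finset.sum_le_sum_of_subset (Finset.range_mono hmn)).trans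
      (Finset.sum_le_sum fun k _ => ?_)
    rw [← kapp_mul_const]
    refine kapp_mono (fun _ => le_rfl) fun z _ => ?_
    unfold Aop
    rw [← ENNReal.tsum_mul_right]
    refine ENNReal.tsum_le_tsum fun y => ?_
    simp only [div_eq_mul_inv, ← mul_assoc]
    gcongr
    exact surv_antitone hsub y (by omega)
  rw [← tsum_kapp_kiter_Aop, ENNReal.tsum_eq_iSup_nat, ENNReal.add_iSup]
  refine iSup_le fun m => le_trans ?_
    (liminf_le_liminf ((eventually_ge_atTop m).mono fun n hn => hineq m n hn))
  rw [← ENNReal.add_liminf_eq]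
  refine add_le_add le_rfl (le_trans (Finset.sum_le_sum fun k _ => ?_) (ENNReal.sum_liminf_le _ _))
  exact (kapp_mono (fun _ => le_rfl) fun z _ => kapp_const_liminf_le (acoef p E u) _ z).trans
    (kapp_const_liminf_le _ _ _)

theorem limsup_le_V (h : IsMonotoneKernel p E) (hsub : ∀ x, ∑' y, p x y ≤ 1)
    (hinf : gexp p 1 = ⊤) {x : G} (hhit : 0 < hitProb p 1 x) :
    limsup (fun n => surv p n x / surv p n 1) atTop ≤ V p E x := by
  obtain ⟨k, hk⟩ := exists_kiter_ne_zero hhit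
  have hk_le : kiter p k 1 x ≤ 1 := (ENNReal.le_tsum x).trans (surv_le_one hsub k 1)
  have hk_top : kiter p k 1 x ≠ ⊤ := ne_top_of_le_ne_top ENNReal.one_ne_top hk_le
  have hs0 := surv_ne_zero hsub hinf
  have hst : ∀ n, surv p n 1 ≠ ⊤ := fun n => ne_top_of_le_ne_top ENNReal.one_ne_top
    (surv_le_one hsub n 1)
  set f : ℕ → G → ℝ≥0∞ := fun n y => surv p n y / surv p n 1 with hf
  have hsplit : ∀ φ : G → ℝ≥0∞, kapp (kiter p k) φ 1 = kiter p k 1 x * φ x +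
      kapp (fun z y => if y = x then 0 else kiter p k z y) φ 1 := fun φ => by
    simp only [kapp]
    rw [ENNReal.tsum_eq_add_tsum_ite x]
    simp only [ite_mul, zero_mul]
  set r : (G → ℝ≥0∞) → ℝ≥0∞ :=
    fun φ => kapp (fun z y => if y = x then 0 else kiter p k z y) φ 1 with hr
  have hV : kiter p k 1 x * V p E x + r (V p E) = 1 := by
    rw [← hsplit, h.kapp_kiter_V_eq hsub hinf k h.one_mem, h.V_one]
  have hf_le : ∀ n, kiter p k 1 x * f n x + r (f n) ≤ 1 := fun n => by
    rw [← hsplit]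
    simp only [hf, div_eq_mul_inv]
    rw [kapp_mul_const, ← surv_add, ← ENNReal.mul_inv_cancel (hs0 n) (hst n)]
    gcongr
    exact surv_antitone hsub 1 (Nat.le_add_left n k)
  have hr_le : r (V p E) ≤ liminf (fun n => r (f n)) atTop := by
    refine le_trans (kapp_mono (fun _ => le_rfl) fun y hy => ?_) (kapp_const_liminf_le _ f 1)
    have hy' : kiter p k 1 y ≠ 0 := fun h0 => hy (by simp [h0])
    exact h.V_le_liminf hsub hinf (h.kiter_mem h.one_mem hy')
  have hr_top : r (V p E) ≠ ⊤ :=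
    ne_top_of_le_ne_top ENNReal.one_ne_top (hV ▸ le_add_self)
  refine (ENNReal.mul_le_mul_iff_right hk hk_top).1 ?_
  rw [← ENNReal.limsup_const_mul_of_ne_top hk_top, ENNReal.eq_sub_of_add_eq hr_top hV]
  calc limsup (fun n => kiter p k 1 x * f n x) atTop
      ≤ limsup (fun n => 1 - r (f n)) atTop := limsup_le_limsup (Eventually.of_forall fun n =>
        ENNReal.le_sub_of_add_le_right
          (ne_top_of_le_ne_top ENNReal.one_ne_top (le_add_self.trans (hf_le n))) (hf_le n))
    _ = 1 - liminf (fun n => r (f n)) atTop := ENNReal.limsup_const_sub _ _ ENNReal.one_ne_top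
    _ ≤ 1 - r (V p E) := tsub_le_tsub_left hr_le 1

end IsMonotoneKernel

end RW

theorem statement13 {G : Type*} [Group G] [Countable G]
    (p : G → G → ℝ≥0∞) (E : Set G)
    (hsupp : ∀ x y, p x y ≠ 0 → x ∈ E ∧ y ∈ E)
    (hsub : ∀ x, (∑' y, p x y) ≤ 1)
    (hirr : ∀ x ∈ E, ∀ y ∈ E, 0 < hitProb p x y)
    (htrans : ∀ x ∈ E, green p x x < ⊤)
    (hone : (1 : G) ∈ E)
    (hmul : ∀ x ∈ E, ∀ y ∈ E, x * y ∈ E)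
    (hmono : ∀ x ∈ E, ∀ y ∈ E, ∀ u ∈ E, p x y ≤ p (x * u) (y * u))
    (hinf : ∀ x ∈ E, gexp p x = ⊤) :
    (∀ x ∈ E, kapp p (V p E) x = V p E x) ∧
    ∀ x ∈ E, Tendsto (fun n => surv p n x / surv p n 1) atTop (nhds (V p E x)) := by
  have h : IsMonotoneKernel p E := ⟨hsupp, hone, hmul, hmono⟩
  exact ⟨fun x hx => h.kapp_V_eq hsub (hinf 1 hone) hx, fun x hx =>
    tendsto_of_le_liminf_of_limsup_le (h.V_le_liminf hsub (hinf 1 hone) hx)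
      (h.limsup_le_V hsub (hinf 1 hone) (hirr 1 hone x hx))⟩
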